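/- arXiv:2411.02821 — 4 statements merged into one kernel-verified Lean document; each statement's English description precedes it below -/
import Mathlib

section
/- A bipartite tournament T is acyclic (contains no directed cycle) if and only if T contains no directed cycle of length 4. -/
open Set

variable {V : Type*}

/-- The arc relation `E` restricted to the vertex set `S` has no directed cycle. -/
def AcyclicOn (E : V → V → Prop) (S : Set V) : Prop :=
  ∀ v : V, ¬ Relation.TransGen (fun x y => x ∈ S ∧ y ∈ S ∧ E x y) v v

/-- `E` is a bipartite tournament with partite sets `A` and `B`. -/
def IsBipartiteTournament (E : V → V → Prop) (A B : Set V) : Prop :=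
  A ∪ B = Set.univ ∧ A ∩ B = ∅ ∧
  (∀ a ∈ A, ∀ b ∈ B, Xor' (E a b) (E b a)) ∧
  (∀ u ∈ A, ∀ v ∈ A, ¬ E u v) ∧
  (∀ u ∈ B, ∀ v ∈ B, ¬ E u v)

/-- `H` is a feedback vertex set: deleting `H` leaves an acyclic digraph. -/
def IsFVS (E : V → V → Prop) (H : Set V) : Prop := AcyclicOn E Hᶜ

/-- A directed cycle of length 4 (a square) on the distinct vertices `a b c d`. -/
def IsDirSquare (E : V → V → Prop) (a b c d : V) : Prop :=
  a ≠ b ∧ a ≠ c ∧ a ≠ d ∧ b ≠ c ∧ b ≠ d ∧ c ≠ d ∧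
  E a b ∧ E b c ∧ E c d ∧ E d a

/-- Out-neighborhood. -/
def OutN (E : V → V → Prop) (v : V) : Set V := {u | E v u}

/-- In-neighborhood. -/
def InN (E : V → V → Prop) (v : V) : Set V := {u | E u v}

/-- The union `X 1 ∪ ⋯ ∪ X (i-1)` of the sets preceding index `i` (1-based). -/
def SeqPrev (X : ℕ → Set V) (i : ℕ) : Set V := {v | ∃ j, 1 ≤ j ∧ j < i ∧ v ∈ X j}

/-- `X 1, …, X l` is the canonical sequence of the digraph induced by `E` on `S`:
`X i` is the set of vertices with no incoming arc in the graph induced on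
`S \ (X 1 ∪ ⋯ ∪ X (i-1))`, `l` is minimal with `X 1 ∪ ⋯ ∪ X l = S`, and
`X` is `∅` outside the indices `1, …, l`. -/
def IsCanonicalSeq (E : V → V → Prop) (S : Set V) (l : ℕ) (X : ℕ → Set V) : Prop :=
  (∀ i, 1 ≤ i → i ≤ l →
    X i = {v | v ∈ S ∧ v ∉ SeqPrev X i ∧ ∀ u ∈ S, u ∉ SeqPrev X i → ¬ E u v}) ∧
  SeqPrev X (l + 1) = S ∧
  (∀ l', l' < l → SeqPrev X (l' + 1) ≠ S) ∧
  (∀ i, i = 0 ∨ l < i → X i = ∅)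

/-- The digraph induced on `S` is `M`-consistent: for every `v ∈ S` the induced
subgraph on `M ∪ {v}` is acyclic. -/
def MConsistentOn (E : V → V → Prop) (S M : Set V) : Prop :=
  ∀ v ∈ S, AcyclicOn E (M ∪ {v})

/-- `u` and `v` are `M`-equivalent. -/
def MEquiv (E : V → V → Prop) (M : Set V) (u v : V) : Prop :=
  OutN E u ∩ M = OutN E v ∩ M ∧ InN E u ∩ M = InN E v ∩ M

/-- `v` is `(M, X i)`-equivalent: `v` is `M`-equivalent to a vertex of `X i`. -/
def MXEquiv (E : V → V → Prop) (M : Set V) (X : ℕ → Set V) (i : ℕ) (v : V) : Prop :=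
  ∃ u ∈ X i, MEquiv E M v u

/-- `v` is `(M, X i)`-conflicting. -/
def MXConflict (E : V → V → Prop) (X : ℕ → Set V) (i : ℕ) (v : V) : Prop :=
  (OutN E v ∩ X i).Nonempty ∧ (InN E v ∩ X i).Nonempty ∧
  (∀ j, j < i → OutN E v ∩ X j = ∅) ∧
  (∀ j, i < j → InN E v ∩ X j = ∅)

/-- `π` is a topological sort of the digraph induced by `E` on `S`. -/
def IsTopSortOn (E : V → V → Prop) (S : Set V) (π : V → ℕ) : Prop :=
  Set.InjOn π S ∧ ∀ u ∈ S, ∀ w ∈ S, E u w → π u < π w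

/-- `v` is `M⁻`-universal (w.r.t. the canonical sequence `X` of `T[M]`). -/
def MUnivMinus (E : V → V → Prop) (M : Set V) (X : ℕ → Set V) (v : V) : Prop :=
  (∀ i, ¬ MXEquiv E M X i v) ∧ AcyclicOn E (M ∪ {v}) ∧
  ∃ π : V → ℕ, IsTopSortOn E (M ∪ {v}) π ∧ ∀ u ∈ M ∪ {v}, u ≠ v → π v < π u

/-- `v` is `M⁺`-universal (w.r.t. the canonical sequence `X` of `T[M]`). -/
def MUnivPlus (E : V → V → Prop) (M : Set V) (X : ℕ → Set V) (v : V) : Prop :=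
  (∀ i, ¬ MXEquiv E M X i v) ∧ AcyclicOn E (M ∪ {v}) ∧
  ∃ π : V → ℕ, IsTopSortOn E (M ∪ {v}) π ∧ ∀ u ∈ M ∪ {v}, u ≠ v → π u < π v

/-- `v` is `M`-universal. -/
def MUniversal (E : V → V → Prop) (M : Set V) (X : ℕ → Set V) (v : V) : Prop :=
  MUnivMinus E M X v ∨ MUnivPlus E M X v

/-- `(X 1, Y 1, …, X l, Y l)` is the `M`-sequence of the digraph induced by `E` on
the vertex set `S`, where `X'` is the canonical sequence of `T[M]`:  `X i` is the set
of all `(M, X' i)`-equivalent vertices of `S` and `Y i` the set of all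
`(M, X' i)`-conflicting vertices of `S`, with `Y 1` additionally containing every
`M⁻`-universal vertex and `Y l` every `M⁺`-universal vertex of `S`. -/
def IsMSeqOn (E : V → V → Prop) (S M : Set V) (l : ℕ) (X' X Y : ℕ → Set V) : Prop :=
  IsCanonicalSeq E M l X' ∧
  (∀ i, 1 ≤ i → i ≤ l → X i = {w | w ∈ S ∧ MXEquiv E M X' i w}) ∧
  (∀ i, 1 ≤ i → i ≤ l → Y i =
    {w | w ∈ S ∧ MXConflict E X' i w} ∪
    (if i = 1 then {w | w ∈ S ∧ MUnivMinus E M X' w} else ∅) ∪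
    (if i = l then {w | w ∈ S ∧ MUnivPlus E M X' w} else ∅)) ∧
  (∀ i, i = 0 ∨ l < i → X i = ∅ ∧ Y i = ∅)

/-- Every collection of at least `t` consecutive vertices of `π` restricted to `S`
contains a vertex of `M`. -/
def ConsecHitsOn (π : V → ℕ) (S M : Set V) (t : ℝ) : Prop :=
  ∀ u ∈ S, ∀ w ∈ S, π u ≤ π w →
    t ≤ ({x | x ∈ S ∧ π u ≤ π x ∧ π x ≤ π w}.ncard : ℝ) →
    ∃ m ∈ M ∩ S, π u ≤ π m ∧ π m ≤ π w

/-- A feedback vertex set `H` is `M`-homogeneous: some topological sort `π` of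
`T − H` is such that every `10 (log₂ k)³` consecutive vertices of `π` restricted to
`A \ H`, respectively to `B \ H`, contain a vertex of `M`. -/
def MHomogeneous (E : V → V → Prop) (A B M H : Set V) (k : ℕ) : Prop :=
  ∃ π : V → ℕ, IsTopSortOn E Hᶜ π ∧
    ConsecHitsOn π (A \ H) M (10 * (Real.logb 2 k) ^ 3) ∧
    ConsecHitsOn π (B \ H) M (10 * (Real.logb 2 k) ^ 3)

/-- The left boundary of block `i`: vertices of `X i` occurring before the first
`M`-vertex of `X i` in the topological sort `π`. -/
def LeftBd (π : V → ℕ) (X : ℕ → Set V) (M : Set V) (i : ℕ) : Set V :=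
  {x | x ∈ X i ∧ ∀ m ∈ X i ∩ M, π x < π m}

/-- The right boundary of block `i`: vertices of `X i` occurring after the last
`M`-vertex of `X i` in the topological sort `π`. -/
def RightBd (π : V → ℕ) (X : ℕ → Set V) (M : Set V) (i : ℕ) : Set V :=
  {x | x ∈ X i ∧ ∀ m ∈ X i ∩ M, π m < π x}

/-- The vicinity of block `i`. -/
def Vicinity (π : V → ℕ) (X Y : ℕ → Set V) (M : Set V) (i : ℕ) : Set V :=
  LeftBd π X M i ∪ RightBd π X M i ∪ Y i ∪ RightBd π X M (i - 1) ∪ LeftBd π X M (i + 1)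

/-- `F` is a `t`-wise independent family of functions from `V` to `{1, …, q}`. -/
def TwiseIndep (F : Finset (V → ℕ)) (t q : ℕ) : Prop :=
  F.Nonempty ∧
  (∀ f ∈ F, ∀ v : V, f v ∈ Finset.Icc 1 q) ∧
  ∀ g : Fin t → V, Function.Injective g →
    ∀ α : Fin t → ℕ, (∀ i, α i ∈ Finset.Icc 1 q) →
      (F.filter fun f => ∀ i, f (g i) = α i).card * q ^ t = F.card

/-- `u` and `v` are false twins. -/
def FalseTwins (E : V → V → Prop) (u v : V) : Prop :=
  ¬ E u v ∧ ¬ E v u ∧ OutN E u = OutN E v ∧ InN E u = InN E v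

/-- The vertex set of a quadruple (used for vertex sets of squares). -/
def quadVerts (q : V × V × V × V) : Set V := {q.1, q.2.1, q.2.2.1, q.2.2.2}

namespace IsBipartiteTournament

variable {E : V → V → Prop} {A B : Set V}

theorem mem_or_mem (hT : IsBipartiteTournament E A B) (x : V) : x ∈ A ∨ x ∈ B := by
  have h : x ∈ A ∪ B := hT.1 ▸ Set.mem_univ x
  exact h

theorem mem_of_arc (hT : IsBipartiteTournament E A B) {x y : V} (h : E x y) :
    (x ∈ A ∧ y ∈ B) ∨ (x ∈ B ∧ y ∈ A) := by
  have hx := hT.mem_or_mem x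
  have hy := hT.mem_or_mem y
  have hA := hT.2.2.2.1 x
  have hB := hT.2.2.2.2 x
  grind

theorem asymm (hT : IsBipartiteTournament E A B) {x y : V} (h : E x y) : ¬ E y x := by
  rcases hT.mem_of_arc h with ⟨hx, hy⟩ | ⟨hx, hy⟩
  · rcases hT.2.2.1 x hx y hy with h' | h'
    · exact h'.2
    · exact absurd h h'.2
  · rcases hT.2.2.1 y hy x hx with h' | h'
    · exact absurd h h'.2
    · exact h'.2

theorem arc_or_arc (hT : IsBipartiteTournament E A B) {x y : V}
    (h : (x ∈ A ∧ y ∈ B) ∨ (x ∈ B ∧ y ∈ A)) : E x y ∨ E y x := by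
  rcases h with ⟨hx, hy⟩ | ⟨hx, hy⟩
  · exact Xor.or (hT.2.2.1 x hx y hy)
  · exact (Xor.or (hT.2.2.1 y hy x hx)).symm

/-- Without directed squares, the endpoints of a walk of length three are joined by an arc. -/
theorem arc_of_arc_arc_arc (hT : IsBipartiteTournament E A B)
    (hS : ¬ ∃ a b c d : V, IsDirSquare E a b c d) {x y z w : V}
    (hxy : E x y) (hyz : E y z) (hzw : E z w) : E x w := by
  have hdisj : ∀ v, v ∈ A → v ∈ B → False := fun v ha hb => by
    have h : v ∈ A ∩ B := ⟨ha, hb⟩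
    simp [hT.2.1] at h
  have hside : (x ∈ A ∧ w ∈ B) ∨ (x ∈ B ∧ w ∈ A) := by
    have h₁ := hT.mem_of_arc hxy
    have h₂ := hT.mem_of_arc hyz
    have h₃ := hT.mem_of_arc hzw
    have hy := hdisj y
    have hz := hdisj z
    tauto
  refine (hT.arc_or_arc hside).resolve_right fun hwx => hS ⟨x, y, z, w, ?_⟩
  have hne : ∀ {u v : V}, E u v → u ≠ v := fun h e => hT.asymm h (e ▸ h)
  refine ⟨hne hxy, ?_, (hne hwx).symm, hne hyz, ?_, hne hzw, hxy, hyz, hzw, hwx⟩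
  · rintro rfl
    exact hT.asymm hxy hyz
  · rintro rfl
    exact hT.asymm hyz hzw

/-- Without directed squares, reachability is witnessed by a walk of length at most two. -/
theorem arc_or_exists_arc_arc_of_transGen (hT : IsBipartiteTournament E A B)
    (hS : ¬ ∃ a b c d : V, IsDirSquare E a b c d) {x y : V} (h : Relation.TransGen E x y) :
    E x y ∨ ∃ m, E x m ∧ E m y := by
  induction h with
  | single h => exact .inl h
  | tail _ hbc ih =>
    rcases ih with hxb | ⟨m, hxm, hmb⟩
    · exact .inr ⟨_, hxb, hbc⟩
    · exact .inl (hT.arc_of_arc_arc_arc hS hxm hmb hbc)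

end IsBipartiteTournament

theorem stmt_0 [Fintype V] (E : V → V → Prop) (A B : Set V)
    (hT : IsBipartiteTournament E A B) :
    AcyclicOn E Set.univ ↔ ¬ ∃ a b c d : V, IsDirSquare E a b c d := by
  simp only [AcyclicOn, Set.mem_univ, true_and]
  constructor
  · rintro h ⟨a, b, c, d, -, -, -, -, -, -, hab, hbc, hcd, hda⟩
    exact h a ((((Relation.TransGen.single hab).tail hbc).tail hcd).tail hda)
  · intro hS v hv
    rcases hT.arc_or_exists_arc_arc_of_transGen hS hv with h | ⟨m, h₁, h₂⟩
    · exact hT.asymm h h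
    · exact hT.asymm h₁ h₂
end

section
/- Let T be a bipartite tournament and let C_1, …, C_m be a maximal (non-extendable) collection of pairwise vertex-disjoint directed cycles of length 4 in T. Then the union S of the vertex sets of C_1, …, C_m is a feedback vertex set of T of size 4m, and every feedback vertex set of T has size at least m. Consequently, if T has a feedback vertex set of size at most k, then S is a feedback vertex set of size at most 4k. -/
open Set

variable {V : Type*}

theorem IsBipartiteTournament.asymm_s1 {E : V → V → Prop} {A B : Set V}
    (hT : IsBipartiteTournament E A B) {x y : V} (hxy : E x y) : ¬ E y x := by
  obtain ⟨hU, -, hX, hA, hB⟩ := hT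
  have hx : x ∈ A ∪ B := hU ▸ mem_univ x
  have hy : y ∈ A ∪ B := hU ▸ mem_univ y
  rcases hx with hx | hx <;> rcases hy with hy | hy
  · exact absurd hxy (hA x hx y hy)
  · rcases hX x hx y hy with h | h
    · exact h.2
    · exact absurd hxy h.2
  · rcases hX y hy x hx with h | h
    · exact absurd hxy h.2
    · exact h.2
  · exact absurd hxy (hB x hx y hy)

theorem IsBipartiteTournament.irrefl {E : V → V → Prop} {A B : Set V}
    (hT : IsBipartiteTournament E A B) (x : V) : ¬ E x x :=
  fun h => hT.asymm_s1 h h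

theorem IsBipartiteTournament.mem_iff_notMem {E : V → V → Prop} {A B : Set V}
    (hT : IsBipartiteTournament E A B) {x y : V} (hxy : E x y) : x ∈ A ↔ y ∉ A := by
  obtain ⟨hU, hI, -, hA, hB⟩ := hT
  have hx : x ∈ A ∪ B := hU ▸ mem_univ x
  have hy : y ∈ A ∪ B := hU ▸ mem_univ y
  constructor
  · exact fun hxA hyA => hA x hxA y hyA hxy
  · intro hyA
    by_contra hxA
    exact hB x (hx.resolve_left hxA) y (hy.resolve_left hyA) hxy

theorem IsBipartiteTournament.adj_or_adj {E : V → V → Prop} {A B : Set V}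
    (hT : IsBipartiteTournament E A B) {x y : V} (hxy : x ∈ A ↔ y ∉ A) : E x y ∨ E y x := by
  obtain ⟨hU, -, hX, -, -⟩ := hT
  have hx : x ∈ A ∪ B := hU ▸ mem_univ x
  have hy : y ∈ A ∪ B := hU ▸ mem_univ y
  by_cases hxA : x ∈ A
  · exact Xor.or (hX x hxA y (hy.resolve_left (hxy.1 hxA)))
  · have hyA : y ∈ A := by tauto
    exact (Xor.or (hX y hyA x (hx.resolve_left hxA))).symm

/-- A directed walk of length three is either closed up to a square or shortcut by an arc. -/
theorem IsBipartiteTournament.adj_or_isDirSquare {E : V → V → Prop} {A B : Set V}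
    (hT : IsBipartiteTournament E A B) {a b c d : V} (hab : E a b) (hbc : E b c) (hcd : E c d) :
    E a d ∨ IsDirSquare E a b c d := by
  have had : a ∈ A ↔ d ∉ A := by
    have h1 := hT.mem_iff_notMem hab
    have h2 := hT.mem_iff_notMem hbc
    have h3 := hT.mem_iff_notMem hcd
    tauto
  refine (hT.adj_or_adj had).imp_right fun hda => ?_
  refine ⟨?_, ?_, ?_, ?_, ?_, ?_, hab, hbc, hcd, hda⟩
  · rintro rfl; exact hT.irrefl _ hab
  · rintro rfl; exact hT.asymm_s1 hab hbc
  · rintro rfl; exact hT.irrefl _ hda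
  · rintro rfl; exact hT.irrefl _ hbc
  · rintro rfl; exact hT.asymm_s1 hbc hcd
  · rintro rfl; exact hT.irrefl _ hcd

/-- A set of vertices of a bipartite tournament spanning no square is acyclic. -/
theorem IsBipartiteTournament.acyclicOn {E : V → V → Prop} {A B S : Set V}
    (hT : IsBipartiteTournament E A B)
    (hS : ∀ a ∈ S, ∀ b ∈ S, ∀ c ∈ S, ∀ d ∈ S, ¬ IsDirSquare E a b c d) : AcyclicOn E S := by
  have key : ∀ x y, Relation.TransGen (fun x y => x ∈ S ∧ y ∈ S ∧ E x y) x y →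
      x ∈ S ∧ y ∈ S ∧ (E x y ∨ ∃ z ∈ S, E x z ∧ E z y) := by
    intro x y h
    induction h with
    | single h => exact ⟨h.1, h.2.1, .inl h.2.2⟩
    | tail _ h ih =>
      obtain ⟨hx, hy, ih⟩ := ih
      refine ⟨hx, h.2.1, ?_⟩
      rcases ih with hxy | ⟨w, hw, hxw, hwy⟩
      · exact .inr ⟨_, hy, hxy, h.2.2⟩
      · exact .inl ((hT.adj_or_isDirSquare hxw hwy h.2.2).resolve_right
          (hS _ hx _ hw _ hy _ h.2.1))
  intro v hv
  obtain ⟨-, -, h | ⟨z, -, h1, h2⟩⟩ := key v v hv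
  · exact hT.irrefl v h
  · exact hT.asymm_s1 h1 h2

theorem IsDirSquare.ncard_quadVerts {E : V → V → Prop} {q : V × V × V × V}
    (h : IsDirSquare E q.1 q.2.1 q.2.2.1 q.2.2.2) : (quadVerts q).ncard = 4 := by
  obtain ⟨hab, hac, had, hbc, hbd, hcd, -⟩ := h
  unfold quadVerts
  rw [ncard_insert_of_notMem (by simp [hab, hac, had]),
    ncard_insert_of_notMem (by simp [hbc, hbd]), ncard_pair hcd]

theorem IsFVS.inter_quadVerts_nonempty {E : V → V → Prop} {H : Set V} (hH : IsFVS E H)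
    {q : V × V × V × V} (h : IsDirSquare E q.1 q.2.1 q.2.2.1 q.2.2.2) :
    (H ∩ quadVerts q).Nonempty := by
  obtain ⟨-, -, -, -, -, -, hab, hbc, hcd, hda⟩ := h
  by_contra hne
  have hmem : ∀ x ∈ quadVerts q, x ∈ Hᶜ := fun x hx hxH => hne ⟨x, hxH, hx⟩
  have ha := hmem q.1 (by simp [quadVerts])
  have hb := hmem q.2.1 (by simp [quadVerts])
  have hc := hmem q.2.2.1 (by simp [quadVerts])
  have hd := hmem q.2.2.2 (by simp [quadVerts])
  exact hH q.1 ((((Relation.TransGen.single ⟨ha, hb, hab⟩).tail ⟨hb, hc, hbc⟩).tail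
    ⟨hc, hd, hcd⟩).tail ⟨hd, ha, hda⟩)

theorem stmt_1 [Fintype V] (E : V → V → Prop) (A B : Set V)
    (hT : IsBipartiteTournament E A B) (m k : ℕ) (C : Fin m → V × V × V × V)
    (hsq : ∀ i : Fin m, IsDirSquare E (C i).1 (C i).2.1 (C i).2.2.1 (C i).2.2.2)
    (hdisj : ∀ i j : Fin m, i ≠ j → quadVerts (C i) ∩ quadVerts (C j) = ∅)
    (hmax : ∀ a b c d : V, IsDirSquare E a b c d →
      ∃ i : Fin m, (({a, b, c, d} : Set V) ∩ quadVerts (C i)).Nonempty) :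
    IsFVS E (⋃ i : Fin m, quadVerts (C i)) ∧
    (⋃ i : Fin m, quadVerts (C i)).ncard = 4 * m ∧
    (∀ H : Set V, IsFVS E H → m ≤ H.ncard) ∧
    ((∃ H : Set V, IsFVS E H ∧ H.ncard ≤ k) → (⋃ i : Fin m, quadVerts (C i)).ncard ≤ 4 * k) := by
  have hcard : (⋃ i : Fin m, quadVerts (C i)).ncard = 4 * m := by
    rw [ncard_iUnion_of_finite (fun _ => toFinite _)
      (fun i j hij => disjoint_iff_inter_eq_empty.2 (hdisj i j hij)),
      finsum_eq_sum_of_fintype]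
    simp [fun i => (hsq i).ncard_quadVerts, mul_comm]
  have hlower : ∀ H : Set V, IsFVS E H → m ≤ H.ncard := by
    intro H hH
    choose f hf using fun i => hH.inter_quadVerts_nonempty (hsq i)
    have hinj : Function.Injective f := by
      intro i j hij
      by_contra hne
      have : f i ∈ quadVerts (C i) ∩ quadVerts (C j) := ⟨(hf i).2, hij ▸ (hf j).2⟩
      simp [hdisj i j hne] at this
    calc m = (range f).ncard := by rw [← image_univ, ncard_image_of_injective _ hinj]; simp
      _ ≤ H.ncard := ncard_le_ncard (range_subset_iff.2 fun i => (hf i).1)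
  refine ⟨hT.acyclicOn ?_, hcard, hlower, ?_⟩
  · intro a ha b hb c hc d hd hs
    obtain ⟨i, x, hx, hxi⟩ := hmax a b c d hs
    have hxS : x ∈ ⋃ i : Fin m, quadVerts (C i) := mem_iUnion.2 ⟨i, hxi⟩
    rcases hx with rfl | rfl | rfl | rfl
    exacts [ha hxS, hb hxS, hc hxS, hd hxS]
  · rintro ⟨H, hH, hk⟩
    have := hlower H hH
    omega
end

section
/- Let T be an acyclic bipartite tournament with canonical sequence V_1, V_2, …, V_l. Then the union of the odd-indexed sets ⋃_{i odd} V_i and the union of the even-indexed sets ⋃_{i even} V_i are exactly the two partite sets of T; in particular every set V_i is entirely contained in one partite set, and consecutive sets V_i, V_{i+1} lie in different partite sets. -/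
open Set

variable {V : Type*}

theorem IsBipartiteTournament.symm {E : V → V → Prop} {A B : Set V}
    (hT : IsBipartiteTournament E A B) : IsBipartiteTournament E B A := by
  obtain ⟨hun, hdisj, hx, hA, hB⟩ := hT
  exact ⟨by rwa [union_comm], by rwa [inter_comm],
    fun b hb a ha => (xor_comm _ _).mp (hx a ha b hb), hB, hA⟩

theorem IsBipartiteTournament.mem_right_of_arc {E : V → V → Prop} {A B : Set V}
    (hT : IsBipartiteTournament E A B) {u v : V} (hu : u ∈ A) (huv : E u v) : v ∈ B := by
  have hv : v ∈ A ∪ B := hT.1 ▸ mem_univ v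
  exact hv.resolve_left fun hv => hT.2.2.2.1 u hu v hv huv

theorem IsBipartiteTournament.subset_or_subset_of_independent {E : V → V → Prop} {A B Y : Set V}
    (hT : IsBipartiteTournament E A B) (hY : ∀ u ∈ Y, ∀ v ∈ Y, ¬ E u v) : Y ⊆ A ∨ Y ⊆ B := by
  by_contra! h
  obtain ⟨⟨u, hu, huA⟩, v, hv, hvB⟩ := h.imp not_subset.mp not_subset.mp
  have huB : u ∈ B := ((hT.1 ▸ mem_univ u : u ∈ A ∪ B)).resolve_left huA
  have hvA : v ∈ A := ((hT.1 ▸ mem_univ v : v ∈ A ∪ B)).resolve_right hvB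
  rcases hT.2.2.1 v hvA u huB with h | h
  · exact hY v hv u hu h.1
  · exact hY u hu v hv h.1

theorem IsCanonicalSeq.not_arc {E : V → V → Prop} {S : Set V} {l : ℕ} {X : ℕ → Set V}
    (hX : IsCanonicalSeq E S l X) {i : ℕ} (hi : 1 ≤ i) (hil : i ≤ l) {u v : V}
    (hu : u ∈ X i) (hv : v ∈ X i) : ¬ E u v := by
  rw [hX.1 i hi hil] at hu hv
  exact hv.2.2 u hu.1 hu.2.1

/-- Every vertex of a later set of the canonical sequence has an in-neighbor in the
preceding set. -/
theorem IsCanonicalSeq.exists_arc {E : V → V → Prop} {S : Set V} {l : ℕ} {X : ℕ → Set V}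
    (hX : IsCanonicalSeq E S l X) {i : ℕ} (hi : 1 ≤ i) (hil : i + 1 ≤ l) {v : V}
    (hv : v ∈ X (i + 1)) : ∃ u ∈ X i, E u v := by
  rw [hX.1 (i + 1) (by omega) hil] at hv
  obtain ⟨hvS, hvp, hvE⟩ := hv
  have hvi : v ∉ X i := fun h => hvp ⟨i, hi, by omega, h⟩
  have hvp' : v ∉ SeqPrev X i := fun ⟨j, hj, hji, h⟩ => hvp ⟨j, hj, by omega, h⟩
  rw [hX.1 i hi (by omega)] at hvi
  have hex : ∃ u ∈ S, u ∉ SeqPrev X i ∧ E u v := by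
    by_contra! h
    exact hvi ⟨hvS, hvp', h⟩
  obtain ⟨u, huS, hup, huv⟩ := hex
  have hu : u ∈ SeqPrev X (i + 1) := by
    by_contra h
    exact hvE u huS h huv
  obtain ⟨j, hj, hji, huj⟩ := hu
  obtain rfl : j = i := by
    by_contra hne
    exact hup ⟨j, hj, by omega, huj⟩
  exact ⟨u, huj, huv⟩

theorem IsCanonicalSeq.consecutive_subset {E : V → V → Prop} {A B S : Set V} {l : ℕ}
    {X : ℕ → Set V} (hT : IsBipartiteTournament E A B) (hX : IsCanonicalSeq E S l X)
    {i : ℕ} (hi : 1 ≤ i) (hil : i + 1 ≤ l) (hA : X i ⊆ A) : X (i + 1) ⊆ B := by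
  intro v hv
  obtain ⟨u, hu, huv⟩ := hX.exists_arc hi hil hv
  exact hT.mem_right_of_arc (hA hu) huv

theorem IsCanonicalSeq.subset_of_parity {E : V → V → Prop} {A B S : Set V} {l : ℕ}
    {X : ℕ → Set V} (hT : IsBipartiteTournament E A B) (hX : IsCanonicalSeq E S l X)
    (h1 : X 1 ⊆ A) {i : ℕ} (hi : 1 ≤ i) (hil : i ≤ l) :
    (i % 2 = 1 → X i ⊆ A) ∧ (i % 2 = 0 → X i ⊆ B) := by
  induction i, hi using Nat.le_induction with
  | base => exact ⟨fun _ => h1, by omega⟩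
  | succ i hi ih =>
    obtain ⟨hodd, heven⟩ := ih (by omega)
    exact ⟨fun hp => hX.consecutive_subset hT.symm hi hil (heven (by omega)),
      fun hp => hX.consecutive_subset hT hi hil (hodd (by omega))⟩

theorem IsCanonicalSeq.partite_sets_eq {E : V → V → Prop} {A B : Set V} {l : ℕ}
    {X : ℕ → Set V} (hT : IsBipartiteTournament E A B) (hX : IsCanonicalSeq E univ l X)
    (h1 : X 1 ⊆ A) :
    {v | ∃ i, 1 ≤ i ∧ i ≤ l ∧ i % 2 = 1 ∧ v ∈ X i} = A ∧
      {v | ∃ i, 1 ≤ i ∧ i ≤ l ∧ i % 2 = 0 ∧ v ∈ X i} = B := by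
  have hdisj : ∀ v, v ∈ A → v ∉ B := fun v ha hb => (hT.2.1 ▸ ⟨ha, hb⟩ : v ∈ (∅ : Set V))
  have hcov : ∀ v, v ∈ SeqPrev X (l + 1) := fun v => hX.2.1 ▸ mem_univ v
  have hpar := fun i hi hil => hX.subset_of_parity hT h1 (i := i) hi hil
  constructor <;> refine Subset.antisymm ?_ fun v hv => ?_
  · rintro v ⟨i, hi, hil, hp, hv⟩
    exact (hpar i hi hil).1 hp hv
  · obtain ⟨i, hi, hil, hvi⟩ := hcov v
    refine ⟨i, hi, by omega, ?_, hvi⟩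
    by_contra hp
    exact hdisj v hv ((hpar i hi (by omega)).2 (by omega) hvi)
  · rintro v ⟨i, hi, hil, hp, hv⟩
    exact (hpar i hi hil).2 hp hv
  · obtain ⟨i, hi, hil, hvi⟩ := hcov v
    refine ⟨i, hi, by omega, ?_, hvi⟩
    by_contra hp
    exact hdisj v ((hpar i hi (by omega)).1 (by omega) hvi) hv

theorem stmt_4 [Fintype V] (E : V → V → Prop) (A B : Set V)
    (hT : IsBipartiteTournament E A B) (hac : AcyclicOn E Set.univ)
    (l : ℕ) (X : ℕ → Set V) (hX : IsCanonicalSeq E Set.univ l X) :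
    (∀ i, 1 ≤ i → i ≤ l → X i ⊆ A ∨ X i ⊆ B) ∧
    (∀ i, 1 ≤ i → i + 1 ≤ l →
      (X i ⊆ A ∧ X (i + 1) ⊆ B) ∨ (X i ⊆ B ∧ X (i + 1) ⊆ A)) ∧
    (({v | ∃ i, 1 ≤ i ∧ i ≤ l ∧ i % 2 = 1 ∧ v ∈ X i} = A ∧
      {v | ∃ i, 1 ≤ i ∧ i ≤ l ∧ i % 2 = 0 ∧ v ∈ X i} = B) ∨
     ({v | ∃ i, 1 ≤ i ∧ i ≤ l ∧ i % 2 = 1 ∧ v ∈ X i} = B ∧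
      {v | ∃ i, 1 ≤ i ∧ i ≤ l ∧ i % 2 = 0 ∧ v ∈ X i} = A)) := by
  have hside : ∀ i, 1 ≤ i → i ≤ l → X i ⊆ A ∨ X i ⊆ B := fun i hi hil =>
    hT.subset_or_subset_of_independent fun u hu v hv => hX.not_arc hi hil hu hv
  refine ⟨hside, fun i hi hil => ?_, ?_⟩
  · exact (hside i hi (by omega)).imp
      (fun h => ⟨h, hX.consecutive_subset hT hi hil h⟩)
      (fun h => ⟨h, hX.consecutive_subset hT.symm hi hil h⟩)
  · have h1 : X 1 ⊆ A ∨ X 1 ⊆ B := by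
      by_cases hl : 1 ≤ l
      · exact hside 1 le_rfl hl
      · exact Or.inl (by simp [hX.2.2.2 1 (by omega)])
    exact h1.imp (hX.partite_sets_eq hT) (hX.partite_sets_eq hT.symm)
end

section
/- Let T be an M-consistent bipartite tournament for some M ⊆ V(T) and let (X_1, X_2, …) be the canonical sequence of T[M]. Then every vertex v ∈ V(T) satisfies exactly one of the following three properties, and in the first two cases the index i is unique: (i) v is (M,X_i)-equivalent for some i; (ii) v is (M,X_i)-conflicting for some i; (iii) v is M-universal. -/
open Set

variable {V : Type*}

namespace IsBipartiteTournament

variable {E : V → V → Prop} {A B : Set V}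

theorem mem_right_iff (hT : IsBipartiteTournament E A B) (x : V) : x ∈ B ↔ x ∉ A := by
  have hu : x ∈ A ∪ B := hT.1 ▸ mem_univ x
  have hi : x ∉ A ∩ B := hT.2.1 ▸ notMem_empty x
  simp only [mem_union, mem_inter_iff] at hu hi
  tauto

/-- Two vertices are adjacent exactly when they lie in different partite sets. -/
theorem adj_iff (hT : IsBipartiteTournament E A B) (x y : V) :
    (E x y ∨ E y x) ↔ ¬ (x ∈ A ↔ y ∈ A) := by
  have hx := hT.mem_right_iff x
  have hy := hT.mem_right_iff y
  obtain ⟨-, -, hAB, hA, hB⟩ := hT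
  have h1 := hAB x
  have h2 := hAB y
  simp only [Xor'] at h1 h2
  have h3 := hA x
  have h4 := hA y
  have h5 := hB x
  have h6 := hB y
  grind

end IsBipartiteTournament

namespace IsCanonicalSeq

variable {E : V → V → Prop} {A B S : Set V} {l : ℕ} {X : ℕ → Set V} {i j : ℕ} {x y : V}

theorem index_bounds (hX : IsCanonicalSeq E S l X) (hx : x ∈ X i) : 1 ≤ i ∧ i ≤ l := by
  by_contra h
  have : X i = ∅ := hX.2.2.2 i (by omega)
  simp [this] at hx

theorem mem_layer_iff (hX : IsCanonicalSeq E S l X) (h1 : 1 ≤ i) (hl : i ≤ l) :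
    x ∈ X i ↔ x ∈ S ∧ x ∉ SeqPrev X i ∧ ∀ u ∈ S, u ∉ SeqPrev X i → ¬ E u x := by
  rw [hX.1 i h1 hl, mem_ofPred_eq]

theorem layer_spec (hX : IsCanonicalSeq E S l X) (hx : x ∈ X i) :
    x ∈ S ∧ x ∉ SeqPrev X i ∧ ∀ u ∈ S, u ∉ SeqPrev X i → ¬ E u x :=
  (hX.mem_layer_iff (hX.index_bounds hx).1 (hX.index_bounds hx).2).1 hx

theorem mem_of_mem_layer (hX : IsCanonicalSeq E S l X) (hx : x ∈ X i) : x ∈ S :=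
  (hX.layer_spec hx).1

theorem exists_layer (hX : IsCanonicalSeq E S l X) (hx : x ∈ S) : ∃ i, x ∈ X i := by
  rw [← hX.2.1] at hx
  obtain ⟨i, -, -, hi⟩ := hx
  exact ⟨i, hi⟩

/-- Arcs of the induced digraph go from earlier layers to later ones. -/
theorem lt_of_arc (hX : IsCanonicalSeq E S l X) (hx : x ∈ X i) (hy : y ∈ X j)
    (h : E x y) : i < j := by
  by_contra! hij
  obtain ⟨hxS, hxp, -⟩ := hX.layer_spec hx
  refine (hX.layer_spec hy).2.2 x hxS (fun ⟨k, hk1, hk, hxk⟩ => hxp ⟨k, hk1, ?_, hxk⟩) h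
  omega

theorem exists_arc_from_prev (hX : IsCanonicalSeq E S l X) (hi : 1 ≤ i) (hy : y ∈ X (i + 1)) :
    ∃ x ∈ X i, E x y := by
  obtain ⟨hyS, hyp, hsrc⟩ := hX.layer_spec hy
  have hil : i ≤ l := by have := hX.index_bounds hy; omega
  have hyi : y ∉ X i := fun h => hyp ⟨i, hi, by omega, h⟩
  rw [hX.mem_layer_iff hi hil] at hyi
  push Not at hyi
  obtain ⟨u, huS, hup, huy⟩ := hyi hyS fun ⟨k, hk1, hk, h⟩ => hyp ⟨k, hk1, by omega, h⟩
  refine ⟨u, ?_, huy⟩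
  by_contra hui
  refine hsrc u huS (fun ⟨k, hk1, hk, h⟩ => ?_) huy
  rcases Nat.lt_succ_iff_lt_or_eq.1 hk with hk | rfl
  · exact hup ⟨k, hk1, hk, h⟩
  · exact hui h

theorem layer_nonempty (hX : IsCanonicalSeq E S l X) (hi : 1 ≤ i) (hij : i ≤ j)
    (hj : (X j).Nonempty) : (X i).Nonempty := by
  induction j, hij using Nat.le_induction with
  | base => exact hj
  | succ k hk ih =>
    obtain ⟨y, hy⟩ := hj
    obtain ⟨x, hx, -⟩ := hX.exists_arc_from_prev (hi.trans hk) hy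
    exact ih ⟨x, hx⟩

theorem same_side (hX : IsCanonicalSeq E S l X) (hT : IsBipartiteTournament E A B)
    (hx : x ∈ X i) (hy : y ∈ X i) : x ∈ A ↔ y ∈ A := by
  by_contra h
  rcases (hT.adj_iff x y).2 h with h | h
  · exact lt_irrefl _ (hX.lt_of_arc hx hy h)
  · exact lt_irrefl _ (hX.lt_of_arc hy hx h)

theorem opposite_side (hX : IsCanonicalSeq E S l X) (hT : IsBipartiteTournament E A B)
    (hx : x ∈ X i) (hy : y ∈ X (i + 1)) : ¬ (x ∈ A ↔ y ∈ A) := by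
  obtain ⟨z, hz, hzy⟩ := hX.exists_arc_from_prev (hX.index_bounds hx).1 hy
  have h1 := (hT.adj_iff z y).1 (Or.inl hzy)
  have h2 := hX.same_side hT hx hz
  tauto

theorem arc_of_lt (hX : IsCanonicalSeq E S l X) (hT : IsBipartiteTournament E A B)
    (hx : x ∈ X i) (hy : y ∈ X j) (hij : i ≤ j) (h : ¬ (x ∈ A ↔ y ∈ A)) : E x y := by
  rcases (hT.adj_iff x y).2 h with h | h
  · exact h
  · have := hX.lt_of_arc hy hx h
    omega

theorem layer_unique (hX : IsCanonicalSeq E S l X) (hi : x ∈ X i) (hj : x ∈ X j) : i = j := by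
  by_contra hne
  rcases lt_or_gt_of_ne hne with h | h
  · exact (hX.layer_spec hj).2.1 ⟨i, (hX.index_bounds hi).1, h, hi⟩
  · exact (hX.layer_spec hi).2.1 ⟨j, (hX.index_bounds hj).1, h, hj⟩

variable {v : V}

/-- Every in-neighbour of `v` lies in a layer no later than that of any out-neighbour. -/
theorem le_of_acyclicOn (hX : IsCanonicalSeq E S l X) (hT : IsBipartiteTournament E A B)
    (hv : AcyclicOn E (S ∪ {v})) (hx : x ∈ X i) (hy : y ∈ X j)
    (hyv : E y v) (hvx : E v x) : j ≤ i := by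
  by_contra! hij
  obtain ⟨w, hw⟩ := hX.layer_nonempty (i := i + 1) (by omega) hij ⟨y, hy⟩
  have hxw := hX.opposite_side hT hx hw
  have h1 := (hT.adj_iff y v).1 (Or.inl hyv)
  have h2 := (hT.adj_iff v x).1 (Or.inl hvx)
  have hxwE := hX.arc_of_lt hT hx hw (by omega) hxw
  have hwyE := hX.arc_of_lt hT hw hy hij (by tauto)
  have mem : ∀ {u k}, u ∈ X k → u ∈ S ∪ {v} := fun h => Or.inl (hX.mem_of_mem_layer h)
  have hvS : v ∈ S ∪ {v} := Or.inr rfl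
  exact hv v ((((Relation.TransGen.single ⟨hvS, mem hx, hvx⟩).tail
    ⟨mem hx, mem hw, hxwE⟩).tail ⟨mem hw, mem hy, hwyE⟩).tail ⟨mem hy, hvS, hyv⟩)

theorem exists_topSort_layered [Fintype V] (hX : IsCanonicalSeq E S l X) :
    ∃ π : V → ℕ, ∃ N, IsTopSortOn E S π ∧ ∀ u ∈ S, 0 < π u ∧ π u < N := by
  classical
  choose! f hf using fun x (hx : x ∈ S) => hX.exists_layer hx
  let e := Fintype.equivFin V
  let n := Fintype.card V
  have he : ∀ u, (e u : ℕ) < n := fun u => (e u).2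
  have hlt : ∀ u w, f u < f w → f u * n + e u < f w * n + e w := fun u w h => by
    have := Nat.mul_le_mul_right n (Nat.succ_le_of_lt h)
    have := he u
    rw [Nat.succ_mul] at *
    omega
  refine ⟨fun u => f u * n + e u + 1, (l + 1) * n + 1, ⟨fun u _ w _ h => ?_,
    fun u hu w hw h => ?_⟩, fun u hu => ⟨by positivity, ?_⟩⟩
  · simp only [add_left_inj] at h
    rcases lt_trichotomy (f u) (f w) with h' | h' | h'
    · exact absurd h (hlt u w h').ne
    · rw [h', add_right_inj] at h
      exact e.injective (Fin.ext h)
    · exact absurd h (hlt w u h').ne'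
  · have := hlt u w (hX.lt_of_arc (hf u hu) (hf w hw) h)
    simpa using this
  · have := Nat.mul_le_mul_right n (hX.index_bounds (hf u hu)).2
    have := he u
    change f u * n + e u + 1 < (l + 1) * n + 1
    rw [Nat.succ_mul]
    omega

theorem mUnivMinus [Fintype V] (hX : IsCanonicalSeq E S l X) (hT : IsBipartiteTournament E A B)
    (hv : AcyclicOn E (S ∪ {v})) (heq : ∀ i, ¬ MXEquiv E S X i v)
    (hin : ∀ u ∈ S, ¬ E u v) : MUnivMinus E S X v := by
  classical
  have hvS : v ∉ S := fun h => by
    obtain ⟨i, hi⟩ := hX.exists_layer h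
    exact heq i ⟨v, hi, rfl, rfl⟩
  obtain ⟨π, N, ⟨hinj, hlt⟩, hb⟩ := hX.exists_topSort_layered
  have hvv : ¬ E v v := fun h => hT.asymm h h
  have hne : ∀ u ∈ S, u ≠ v := fun u hu h => hvS (h ▸ hu)
  refine ⟨heq, hv, fun u => if u = v then 0 else π u, ⟨?_, ?_⟩, ?_⟩
  · rintro u (hu | rfl) w (hw | rfl) h
    · simp only [hne u hu, hne w hw, if_false] at h
      exact hinj hu hw h
    · have := hb u hu
      simp [hne u hu] at h
      omega
    · have := hb w hw
      simp [hne w hw] at h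
      omega
    · rfl
  · rintro u (hu | rfl) w (hw | rfl) h
    · simpa [hne u hu, hne w hw] using hlt u hu w hw h
    · exact absurd h (hin u hu)
    · simpa [hne w hw] using (hb w hw).1
    · exact absurd h hvv
  · rintro u (hu | rfl) h
    · simpa [h] using (hb u hu).1
    · exact absurd rfl h

theorem mUnivPlus [Fintype V] (hX : IsCanonicalSeq E S l X) (hT : IsBipartiteTournament E A B)
    (hv : AcyclicOn E (S ∪ {v})) (heq : ∀ i, ¬ MXEquiv E S X i v)
    (hout : ∀ u ∈ S, ¬ E v u) : MUnivPlus E S X v := by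
  classical
  have hvS : v ∉ S := fun h => by
    obtain ⟨i, hi⟩ := hX.exists_layer h
    exact heq i ⟨v, hi, rfl, rfl⟩
  obtain ⟨π, N, ⟨hinj, hlt⟩, hb⟩ := hX.exists_topSort_layered
  have hvv : ¬ E v v := fun h => hT.asymm h h
  have hne : ∀ u ∈ S, u ≠ v := fun u hu h => hvS (h ▸ hu)
  refine ⟨heq, hv, fun u => if u = v then N else π u, ⟨?_, ?_⟩, ?_⟩
  · rintro u (hu | rfl) w (hw | rfl) h
    · simp only [hne u hu, hne w hw, if_false] at h
      exact hinj hu hw h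
    · have := hb u hu
      simp [hne u hu] at h
      omega
    · have := hb w hw
      simp [hne w hw] at h
      omega
    · rfl
  · rintro u (hu | rfl) w (hw | rfl) h
    · simpa [hne u hu, hne w hw] using hlt u hu w hw h
    · simpa [hne u hu] using (hb u hu).2
    · exact absurd h (hout w hw)
    · exact absurd h hvv
  · rintro u (hu | rfl) h
    · simpa [h] using (hb u hu).2
    · exact absurd rfl h

end IsCanonicalSeq

theorem MEquiv.out_iff {E : V → V → Prop} {M : Set V} {u v w : V} (h : MEquiv E M u v)
    (hw : w ∈ M) : E u w ↔ E v w := by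
  have := Set.ext_iff.1 h.1 w
  simpa [OutN, hw] using this

theorem MEquiv.in_iff {E : V → V → Prop} {M : Set V} {u v w : V} (h : MEquiv E M u v)
    (hw : w ∈ M) : E w u ↔ E w v := by
  have := Set.ext_iff.1 h.2 w
  simpa [InN, hw] using this

section Classification

variable {E : V → V → Prop} {A B M : Set V} {l : ℕ} {X : ℕ → Set V} {i j : ℕ} {v : V}

theorem MXEquiv.not_index_lt (hX : IsCanonicalSeq E M l X) (hT : IsBipartiteTournament E A B)
    (hi : MXEquiv E M X i v) (hj : MXEquiv E M X j v) : ¬ i < j := by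
  intro hij
  obtain ⟨u, hu, hvu⟩ := hi
  obtain ⟨w, hw, hvw⟩ := hj
  have huw : ∀ {z}, z ∈ M → E u z → E w z := fun hz h =>
    (hvw.out_iff hz).1 ((hvu.out_iff hz).2 h)
  by_cases hside : u ∈ A ↔ w ∈ A
  · obtain ⟨z, hz⟩ := hX.layer_nonempty (i := i + 1) (by omega) hij ⟨w, hw⟩
    have huz := hX.arc_of_lt hT hu hz (by omega) (hX.opposite_side hT hu hz)
    have := hX.lt_of_arc hw hz (huw (hX.mem_of_mem_layer hz) huz)
    omega
  · have := huw (hX.mem_of_mem_layer hw) (hX.arc_of_lt hT hu hw hij.le hside)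
    exact hT.asymm this this

theorem MXEquiv.index_unique (hX : IsCanonicalSeq E M l X) (hT : IsBipartiteTournament E A B)
    (hi : MXEquiv E M X i v) (hj : MXEquiv E M X j v) : i = j :=
  le_antisymm (not_lt.1 (hj.not_index_lt hX hT hi)) (not_lt.1 (hi.not_index_lt hX hT hj))

theorem MXConflict.not_index_lt (hi : MXConflict E X i v) (hj : MXConflict E X j v) : ¬ i < j :=
  fun hij => hi.1.ne_empty (hj.2.2.1 i hij)

theorem MXConflict.index_unique (hi : MXConflict E X i v) (hj : MXConflict E X j v) : i = j :=
  le_antisymm (not_lt.1 (hj.not_index_lt hi)) (not_lt.1 (hi.not_index_lt hj))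

theorem MXEquiv.not_mXConflict (hX : IsCanonicalSeq E M l X)
    (hi : MXEquiv E M X i v) : ¬ MXConflict E X j v := by
  rintro ⟨⟨a, hva, ha⟩, ⟨b, hbv, hb⟩, -⟩
  obtain ⟨u, hu, hvu⟩ := hi
  have h1 := hX.lt_of_arc hu ha ((hvu.out_iff (hX.mem_of_mem_layer ha)).1 hva)
  have h2 := hX.lt_of_arc hb hu ((hvu.in_iff (hX.mem_of_mem_layer hb)).1 hbv)
  omega

theorem MUniversal.not_mXEquiv (h : MUniversal E M X v) : ¬ MXEquiv E M X i v := by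
  rcases h with h | h <;> exact h.1 i

theorem MUniversal.not_mXConflict (hX : IsCanonicalSeq E M l X)
    (hT : IsBipartiteTournament E A B) (h : MUniversal E M X v) : ¬ MXConflict E X i v := by
  rintro ⟨⟨a, hva, ha⟩, ⟨b, hbv, hb⟩, -⟩
  have hvv : ¬ E v v := fun h => hT.asymm h h
  have hvS : v ∈ M ∪ {v} := Or.inr rfl
  have haS : a ∈ M ∪ {v} := Or.inl (hX.mem_of_mem_layer ha)
  have hbS : b ∈ M ∪ {v} := Or.inl (hX.mem_of_mem_layer hb)
  rcases h with ⟨-, -, π, ⟨-, hlt⟩, hext⟩ | ⟨-, -, π, ⟨-, hlt⟩, hext⟩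
  · exact lt_asymm (hlt b hbS v hvS hbv) (hext b hbS fun h => hvv (h ▸ hbv))
  · exact lt_asymm (hlt v hvS a haS hva) (hext a haS fun h => hvv (h ▸ hva))

/-- A vertex with both in- and out-neighbours in `M` is equivalent to a vertex of `M` or
conflicting with a layer. -/
theorem IsCanonicalSeq.exists_mXEquiv_or_mXConflict (hX : IsCanonicalSeq E M l X)
    (hT : IsBipartiteTournament E A B) (hv : AcyclicOn E (M ∪ {v}))
    (hin : ∃ u ∈ M, E u v) (hout : ∃ u ∈ M, E v u) :
    (∃ i, MXEquiv E M X i v) ∨ ∃ i, MXConflict E X i v := by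
  classical
  have hex : ∃ i, ∃ x ∈ X i, E v x := by
    obtain ⟨x, hxM, hvx⟩ := hout
    obtain ⟨i, hi⟩ := hX.exists_layer hxM
    exact ⟨i, x, hi, hvx⟩
  obtain ⟨x, hx, hvx⟩ := Nat.find_spec hex
  have hmin : ∀ i, ∀ z ∈ X i, E v z → Nat.find hex ≤ i := fun i z hz hvz =>
    Nat.find_min' hex ⟨z, hz, hvz⟩
  generalize Nat.find hex = k at hx hmin
  by_cases hboth : ∃ y ∈ X k, E y v
  · right
    obtain ⟨y, hy, hyv⟩ := hboth
    refine ⟨k, ⟨x, hvx, hx⟩, ⟨y, hyv, hy⟩, fun j hj => ?_, fun j hj => ?_⟩ <;>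
      refine eq_empty_of_forall_notMem ?_
    · rintro z ⟨hvz, hz⟩
      have := hmin j z hz hvz
      omega
    · rintro z ⟨hzv, hz⟩
      have := hX.le_of_acyclicOn hT hv hx hz hzv hvx
      omega
  · left
    have hlt : ∀ i, ∀ z ∈ X i, E z v → i < k := fun i z hz hzv =>
      lt_of_le_of_ne (hX.le_of_acyclicOn hT hv hx hz hzv hvx)
        fun h => hboth ⟨z, h ▸ hz, hzv⟩
    obtain ⟨y, hyM, hyv⟩ := hin
    obtain ⟨j, hy⟩ := hX.exists_layer hyM
    have hjk := hlt j y hy hyv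
    have hj1 := (hX.index_bounds hy).1
    obtain ⟨m, rfl⟩ : ∃ m, k = m + 1 := ⟨k - 1, by omega⟩
    obtain ⟨u, hu⟩ := hX.layer_nonempty (i := m) (by omega) (by omega) ⟨x, hx⟩
    have hside : v ∈ A ↔ u ∈ A := by
      have h1 := hX.opposite_side hT hu hx
      have h2 := (hT.adj_iff v x).1 (Or.inl hvx)
      tauto
    have key : ∀ z ∈ M, (E v z ↔ E u z) ∧ (E z v ↔ E z u) := by
      intro z hz
      obtain ⟨i, hi⟩ := hX.exists_layer hz
      have hadj := hT.adj_iff v z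
      rw [hside, ← hT.adj_iff u z] at hadj
      have h1 := hmin i z hi
      have h2 := hlt i z hi
      have h3 := hX.lt_of_arc hu hi
      have h4 := hX.lt_of_arc hi hu
      grind
    refine ⟨m, u, hu, ?_, ?_⟩ <;> ext z <;> simp only [OutN, InN, mem_inter_iff, mem_ofPred_eq]
    · exact and_congr_left fun hz => (key z hz).1
    · exact and_congr_left fun hz => (key z hz).2

end Classification

theorem stmt_6 [Fintype V] (E : V → V → Prop) (A B : Set V)
    (hT : IsBipartiteTournament E A B) (M : Set V)
    (hcons : MConsistentOn E Set.univ M)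
    (l : ℕ) (X' : ℕ → Set V) (hX : IsCanonicalSeq E M l X') :
    ∀ v : V,
      ((∃! i, MXEquiv E M X' i v) ∧ ¬ (∃ i, MXConflict E X' i v) ∧
        ¬ MUniversal E M X' v) ∨
      ((∃! i, MXConflict E X' i v) ∧ ¬ (∃ i, MXEquiv E M X' i v) ∧
        ¬ MUniversal E M X' v) ∨
      (MUniversal E M X' v ∧ ¬ (∃ i, MXEquiv E M X' i v) ∧
        ¬ (∃ i, MXConflict E X' i v)) := by
  intro v
  have hv := hcons v (mem_univ v)
  by_cases heq : ∃ i, MXEquiv E M X' i v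
  · obtain ⟨i, hi⟩ := heq
    exact Or.inl ⟨⟨i, hi, fun j hj => hj.index_unique hX hT hi⟩,
      fun ⟨j, hj⟩ => hi.not_mXConflict hX hj, fun h => h.not_mXEquiv hi⟩
  by_cases hconf : ∃ i, MXConflict E X' i v
  · obtain ⟨i, hi⟩ := hconf
    exact Or.inr (Or.inl ⟨⟨i, hi, fun j hj => hj.index_unique hi⟩, heq,
      fun h => h.not_mXConflict hX hT hi⟩)
  refine Or.inr (Or.inr ⟨?_, heq, hconf⟩)
  by_cases hin : ∃ u ∈ M, E u v
  · by_cases hout : ∃ u ∈ M, E v u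
    · exact absurd (hX.exists_mXEquiv_or_mXConflict hT hv hin hout) (not_or.2 ⟨heq, hconf⟩)
    · exact Or.inr (hX.mUnivPlus hT hv (not_exists.1 heq) fun u hu h => hout ⟨u, hu, h⟩)
  · exact Or.inl (hX.mUnivMinus hT hv (not_exists.1 heq) fun u hu h => hin ⟨u, hu, h⟩)
end
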